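/- arXiv:2408.00697 — 6 statements merged into one kernel-verified Lean document; each statement's English description precedes it below -/
import Mathlib

section
/- The linearization of the satellite control system at the equilibrium (x_e, 0) is not controllable: for the 6×6 matrix A and the 6×3 matrix B given by the Jacobians of the dynamics at (x_e, 0), the rank of the 6×18 Kalman block matrix [B, AB, A²B, A³B, A⁴B, A⁵B] is at most 4; in particular it is strictly less than 6, so Kalman's controllability condition fails. Here A has nonzero entries A(1,4) = 6ω0²(I3−I2)/I1, A(2,3) = (I1−I3)ω0/I2, A(2,5) = 6ω0²(I3−I1)/I2, A(3,2) = (I2−I1)ω0/I3, A(4,1) = 1/2, A(5,2) = 1/2, A(5,6) = −ω0, A(6,3) = 1/2, A(6,5) = ω0, and all other entries zero; B has nonzero entries B(2,3) = β/I2, B(3,2) = −β/I3, and all other entries zero. -/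
/-- If `D` commutes with `A` and fixes the columns of `B`, then the rank of the Kalman block matrix
of `(A, B)` is at most the rank of `D`. -/
theorem Matrix.rank_kalman_le_of_commute {R n m : Type*} [Field R] [Fintype n] [DecidableEq n]
    [Fintype m] {A D : Matrix n n R} {B : Matrix n m R} (hDA : Commute D A) (hDB : D * B = B)
    (N : ℕ) :
    (Matrix.of fun i (p : Fin N × m) => (A ^ (p.1 : ℕ) * B) i p.2).rank ≤ D.rank := by
  have hfix (k : ℕ) : D * (A ^ k * B) = A ^ k * B := by
    rw [← Matrix.mul_assoc, (hDA.pow_right k).eq, Matrix.mul_assoc, hDB]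
  set K : Matrix n (Fin N × m) R := Matrix.of fun i p => (A ^ (p.1 : ℕ) * B) i p.2
  have hDK : D * K = K := by
    ext i p
    exact congrFun (congrFun (hfix p.1) i) p.2
  rw [← hDK]
  exact Matrix.rank_mul_le_left D K

/-- the linearization of the satellite system at the equilibrium is not
controllable: the Kalman block matrix [B, AB, A²B, A³B, A⁴B, A⁵B] (realized as a matrix
indexed by `Fin 6 × (Fin 6 × Fin 3)`, the block `p.1` holding `A^p.1 * B`) has rank at
most 4, in particular strictly less than 6. -/
theorem linearization_not_controllable (I1 I2 I3 om b : ℝ)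
    (hI1 : 0 < I1) (hI2 : 0 < I2) (hI3 : 0 < I3) (hom : om ≠ 0) (hb : b ≠ 0)
    (A : Matrix (Fin 6) (Fin 6) ℝ)
    (hA : A = !![0, 0, 0, 6 * om ^ 2 * (I3 - I2) / I1, 0, 0;
                 0, 0, (I1 - I3) / I2 * om, 0, 6 * om ^ 2 * (I3 - I1) / I2, 0;
                 0, (I2 - I1) / I3 * om, 0, 0, 0, 0;
                 1 / 2, 0, 0, 0, 0, 0;
                 0, 1 / 2, 0, 0, 0, -om;
                 0, 0, 1 / 2, 0, om, 0])
    (B : Matrix (Fin 6) (Fin 3) ℝ)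
    (hB : B = !![0, 0, 0;
                 0, 0, b / I2;
                 0, -(b / I3), 0;
                 0, 0, 0;
                 0, 0, 0;
                 0, 0, 0])
    (K : Matrix (Fin 6) (Fin 6 × Fin 3) ℝ)
    (hK : K = Matrix.of fun i p => (A ^ (p.1 : ℕ) * B) i p.2) :
    K.rank ≤ 4 ∧ K.rank < 6 := by
  suffices h : K.rank ≤ 4 from ⟨h, by omega⟩
  let w : Fin 6 → ℝ := ![0, 1, 1, 0, 1, 1]
  have hDA : Commute (Matrix.diagonal w) A := by
    ext i j
    rw [hA, Matrix.diagonal_mul, Matrix.mul_diagonal]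
    fin_cases i <;> fin_cases j <;> simp [w]
  have hDB : Matrix.diagonal w * B = B := by
    ext i j
    rw [hB, Matrix.diagonal_mul]
    fin_cases i <;> fin_cases j <;> simp [w]
  have hw : Fintype.card {i // w i ≠ 0} = 4 := by
    rw [Fintype.card_subtype]
    simp [w, Finset.card_filter, Fin.sum_univ_succ]
  calc K.rank ≤ (Matrix.diagonal w).rank := hK ▸ Matrix.rank_kalman_le_of_commute hDA hDB 6
    _ = Fintype.card {i // w i ≠ 0} := Matrix.rank_diagonal w
    _ ≤ 4 := hw.le
end

section
/- The Lie bracket g6 := [f0, f2], evaluated at the equilibrium x_e = (−ω0, 0, 0, 0, 0, 0), equals the vector (0, ω0·β·(I1−I3)/(I2·I3), 0, 0, 0, β/(2·I3)). -/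
/- State x = (ω1, ω2, ω3, q1, q2, q3) : indices 0..5.  q4 = √(1 − q1² − q2² − q3²). -/
noncomputable def q4 (x : Fin 6 → ℝ) : ℝ := Real.sqrt (1 - x 3 ^ 2 - x 4 ^ 2 - x 5 ^ 2)

/-- Drift vector field of the satellite system. -/
noncomputable def f0 (I1 I2 I3 om : ℝ) (x : Fin 6 → ℝ) : Fin 6 → ℝ :=
  ![(I2 - I3) / I1 * (x 1 * x 2)
      + 6 * om ^ 2 * (I2 - I3) / I1 * ((x 3 * q4 x + x 4 * x 5) * (2 * x 3 ^ 2 + 2 * x 4 ^ 2 - 1)),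
    (I3 - I1) / I2 * (x 0 * x 2)
      + 6 * om ^ 2 * (I3 - I1) / I2 * ((x 3 * x 5 - x 4 * q4 x) * (2 * x 3 ^ 2 + 2 * x 4 ^ 2 - 1)),
    (I1 - I2) / I3 * (x 0 * x 1)
      + 12 * om ^ 2 * (I1 - I2) / I3 * ((x 3 * q4 x + x 4 * x 5) * (x 4 * q4 x - x 3 * x 5)),
    (1 / 2) * ((x 0 + om) * q4 x - x 1 * x 5 + x 2 * x 4),
    (1 / 2) * ((x 0 - om) * x 5 + x 1 * q4 x - x 2 * x 3),
    (1 / 2) * (-(x 0 - om) * x 4 + x 1 * x 3 + x 2 * q4 x)]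

/-- Controlled vector field f1. -/
noncomputable def f1 (I2 I3 b : ℝ) (x : Fin 6 → ℝ) : Fin 6 → ℝ :=
  ![0, -2 * b * (x 3 * x 5 + x 4 * q4 x) / I2, 2 * b * (x 3 * x 4 - x 5 * q4 x) / I3, 0, 0, 0]

/-- Controlled vector field f2. -/
noncomputable def f2 (I1 I3 b : ℝ) (x : Fin 6 → ℝ) : Fin 6 → ℝ :=
  ![2 * b * (x 3 * x 5 + x 4 * q4 x) / I1, 0, b * (2 * x 4 ^ 2 + 2 * x 5 ^ 2 - 1) / I3, 0, 0, 0]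

/-- Controlled vector field f3. -/
noncomputable def f3 (I1 I2 b : ℝ) (x : Fin 6 → ℝ) : Fin 6 → ℝ :=
  ![2 * b * (x 5 * q4 x - x 3 * x 4) / I1, b * (1 - 2 * x 4 ^ 2 - 2 * x 5 ^ 2) / I2, 0, 0, 0, 0]

/-- Lie bracket of vector fields: [f,g](x) = Dg(x)·f(x) − Df(x)·g(x). -/
noncomputable def lieB (f g : (Fin 6 → ℝ) → (Fin 6 → ℝ)) (x : Fin 6 → ℝ) : Fin 6 → ℝ :=
  fderiv ℝ g x (f x) - fderiv ℝ f x (g x)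

/-- The equilibrium point x_e = (−ω0, 0, 0, 0, 0, 0). -/
noncomputable def xe (om : ℝ) : Fin 6 → ℝ := ![-om, 0, 0, 0, 0, 0]

theorem q4_differentiableAt {x : Fin 6 → ℝ} (hx : 1 - x 3 ^ 2 - x 4 ^ 2 - x 5 ^ 2 ≠ 0) :
    DifferentiableAt ℝ q4 x := by
  unfold q4
  exact DifferentiableAt.sqrt (by fun_prop) hx

theorem f0_differentiableAt (I1 I2 I3 om : ℝ) {x : Fin 6 → ℝ}
    (hx : 1 - x 3 ^ 2 - x 4 ^ 2 - x 5 ^ 2 ≠ 0) :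
    DifferentiableAt ℝ (f0 I1 I2 I3 om) x := by
  have hq := q4_differentiableAt hx
  rw [differentiableAt_pi]
  intro i
  fin_cases i <;> simp only [f0] <;> simp <;> fun_prop

theorem f0_xe (I1 I2 I3 om : ℝ) : f0 I1 I2 I3 om (xe om) = 0 := by
  ext i
  fin_cases i <;> simp [f0, xe]

theorem f2_xe (I1 I3 b : ℝ) (om : ℝ) : f2 I1 I3 b (xe om) = ![0, 0, -b / I3, 0, 0, 0] := by
  ext i
  fin_cases i <;> simp [f2, xe]

/-- Along the `ω3`-axis through the equilibrium, the drift is linear. -/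
theorem f0_xe_add_smul (I1 I2 I3 om c t : ℝ) :
    f0 I1 I2 I3 om (xe om + t • ![0, 0, c, 0, 0, 0])
      = t • ![0, (I3 - I1) / I2 * (-om * c), 0, 0, 0, c / 2] := by
  ext i
  fin_cases i <;> simp [f0, xe, q4] <;> ring

theorem fderiv_f0_xe (I1 I2 I3 om c : ℝ) :
    fderiv ℝ (f0 I1 I2 I3 om) (xe om) ![0, 0, c, 0, 0, 0]
      = ![0, (I3 - I1) / I2 * (-om * c), 0, 0, 0, c / 2] := by
  have hd : DifferentiableAt ℝ (f0 I1 I2 I3 om) (xe om) :=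
    f0_differentiableAt I1 I2 I3 om (by simp [xe])
  rw [← hd.lineDeriv_eq_fderiv, lineDeriv]
  simp only [f0_xe_add_smul]
  simpa using ((hasDerivAt_id (0 : ℝ)).smul_const
    ![0, (I3 - I1) / I2 * (-om * c), 0, 0, 0, c / 2]).deriv

/-- g6 = [f0, f2] evaluated at x_e. -/
theorem bracket_g6_at_equilibrium (I1 I2 I3 om b : ℝ)
    (hI1 : 0 < I1) (hI2 : 0 < I2) (hI3 : 0 < I3) (hom : om ≠ 0) (hb : b ≠ 0) :
    lieB (f0 I1 I2 I3 om) (f2 I1 I3 b) (xe om)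
      = ![0, om * b * (I1 - I3) / (I2 * I3), 0, 0, 0, b / (2 * I3)] := by
  rw [lieB, f0_xe, map_zero, f2_xe, fderiv_f0_xe]
  ext i
  fin_cases i <;> simp <;> field_simp
  ring
end

section
/- The iterated Lie bracket g4 := [f2, [f0, [f0, f3]]], evaluated at the equilibrium x_e = (−ω0, 0, 0, 0, 0, 0), equals ( 0, 0, 0, β²·(I2+I3−I1)/(2·I1·I2·I3), 0, 0 ), i.e. the scalar β²(I2+I3−I1)/(2I1I2I3) times the fourth standard basis vector of ℝ^6. -/
theorem fderiv_apply_of_hasDerivAt_line {f : (Fin 6 → ℝ) → (Fin 6 → ℝ)} {x v f' : Fin 6 → ℝ}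
    (hf : DifferentiableAt ℝ f x) (h : HasDerivAt (fun t : ℝ => f (x + t • v)) f' 0) :
    fderiv ℝ f x v = f' := by
  rw [← hf.lineDeriv_eq_fderiv]
  exact HasLineDerivAt.lineDeriv h

theorem contDiffAt_lieB {f g : (Fin 6 → ℝ) → (Fin 6 → ℝ)} {x : Fin 6 → ℝ}
    (hf : ContDiffAt ℝ (⊤ : ℕ∞) f x) (hg : ContDiffAt ℝ (⊤ : ℕ∞) g x) :
    ContDiffAt ℝ (⊤ : ℕ∞) (lieB f g) x := by
  unfold lieB
  exact ((hg.fderiv_right (m := (⊤ : ℕ∞)) le_rfl).clm_apply hf).sub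
    ((hf.fderiv_right (m := (⊤ : ℕ∞)) le_rfl).clm_apply hg)

theorem contDiffAt_q4 {x : Fin 6 → ℝ} (hx : 0 < 1 - x 3 ^ 2 - x 4 ^ 2 - x 5 ^ 2) :
    ContDiffAt ℝ (⊤ : ℕ∞) q4 x := by
  unfold q4
  exact ContDiffAt.sqrt (by fun_prop) hx.ne'

theorem contDiffAt_f0 (I1 I2 I3 om : ℝ) {x : Fin 6 → ℝ}
    (hx : 0 < 1 - x 3 ^ 2 - x 4 ^ 2 - x 5 ^ 2) :
    ContDiffAt ℝ (⊤ : ℕ∞) (f0 I1 I2 I3 om) x := by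
  have hq := contDiffAt_q4 hx
  rw [contDiffAt_pi]
  intro i
  fin_cases i <;> simp [f0] <;> fun_prop

theorem contDiffAt_f2 (I1 I3 b : ℝ) {x : Fin 6 → ℝ}
    (hx : 0 < 1 - x 3 ^ 2 - x 4 ^ 2 - x 5 ^ 2) :
    ContDiffAt ℝ (⊤ : ℕ∞) (f2 I1 I3 b) x := by
  have hq := contDiffAt_q4 hx
  rw [contDiffAt_pi]
  intro i
  fin_cases i <;> simp [f2] <;> fun_prop

theorem contDiffAt_f3 (I1 I2 b : ℝ) {x : Fin 6 → ℝ}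
    (hx : 0 < 1 - x 3 ^ 2 - x 4 ^ 2 - x 5 ^ 2) :
    ContDiffAt ℝ (⊤ : ℕ∞) (f3 I1 I2 b) x := by
  have hq := contDiffAt_q4 hx
  rw [contDiffAt_pi]
  intro i
  fin_cases i <;> simp [f3] <;> fun_prop

/-- The derivative of `q4` at `x` in the direction `v`. -/
noncomputable def dq4 (x v : Fin 6 → ℝ) : ℝ :=
  -(x 3 * v 3 + x 4 * v 4 + x 5 * v 5) / q4 x

theorem hasDerivAt_coord_line (x v : Fin 6 → ℝ) (i : Fin 6) :
    HasDerivAt (fun t : ℝ => (x + t • v) i) (v i) 0 := by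
  simpa using ((hasDerivAt_id (0 : ℝ)).mul_const (v i)).const_add (x i)

theorem hasDerivAt_q4_line {x : Fin 6 → ℝ} (hx : 0 < 1 - x 3 ^ 2 - x 4 ^ 2 - x 5 ^ 2)
    (v : Fin 6 → ℝ) : HasDerivAt (fun t : ℝ => q4 (x + t • v)) (dq4 x v) 0 := by
  have H := hasDerivAt_coord_line x v
  have h := ((((H 3).pow 2).const_sub 1).sub ((H 4).pow 2)).sub ((H 5).pow 2)
  have h' := h.sqrt (by simpa using hx.ne')
  refine h'.congr_deriv ?_
  have hq : Real.sqrt (1 - x 3 ^ 2 - x 4 ^ 2 - x 5 ^ 2) ≠ 0 := (Real.sqrt_pos.2 hx).ne'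
  simp [dq4, q4]
  field_simp
  ring

/-- The derivative of `f0` at `x` in the direction `v`. -/
noncomputable def df0 (I1 I2 I3 om : ℝ) (x v : Fin 6 → ℝ) : Fin 6 → ℝ :=
  ![(I2 - I3) / I1 * (v 1 * x 2 + x 1 * v 2)
      + 6 * om ^ 2 * (I2 - I3) / I1 *
        ((v 3 * q4 x + x 3 * dq4 x v + (v 4 * x 5 + x 4 * v 5)) * (2 * x 3 ^ 2 + 2 * x 4 ^ 2 - 1)
          + (x 3 * q4 x + x 4 * x 5) * (4 * x 3 * v 3 + 4 * x 4 * v 4)),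
    (I3 - I1) / I2 * (v 0 * x 2 + x 0 * v 2)
      + 6 * om ^ 2 * (I3 - I1) / I2 *
        ((v 3 * x 5 + x 3 * v 5 - (v 4 * q4 x + x 4 * dq4 x v)) * (2 * x 3 ^ 2 + 2 * x 4 ^ 2 - 1)
          + (x 3 * x 5 - x 4 * q4 x) * (4 * x 3 * v 3 + 4 * x 4 * v 4)),
    (I1 - I2) / I3 * (v 0 * x 1 + x 0 * v 1)
      + 12 * om ^ 2 * (I1 - I2) / I3 *
        ((v 3 * q4 x + x 3 * dq4 x v + (v 4 * x 5 + x 4 * v 5)) * (x 4 * q4 x - x 3 * x 5)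
          + (x 3 * q4 x + x 4 * x 5) *
            (v 4 * q4 x + x 4 * dq4 x v - (v 3 * x 5 + x 3 * v 5))),
    (1 / 2) * (v 0 * q4 x + (x 0 + om) * dq4 x v - (v 1 * x 5 + x 1 * v 5)
      + (v 2 * x 4 + x 2 * v 4)),
    (1 / 2) * (v 0 * x 5 + (x 0 - om) * v 5 + (v 1 * q4 x + x 1 * dq4 x v)
      - (v 2 * x 3 + x 2 * v 3)),
    (1 / 2) * (-v 0 * x 4 + -(x 0 - om) * v 4 + (v 1 * x 3 + x 1 * v 3)
      + (v 2 * q4 x + x 2 * dq4 x v))]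

theorem fderiv_f0_apply (I1 I2 I3 om : ℝ) {x : Fin 6 → ℝ}
    (hx : 0 < 1 - x 3 ^ 2 - x 4 ^ 2 - x 5 ^ 2) (v : Fin 6 → ℝ) :
    fderiv ℝ (f0 I1 I2 I3 om) x v = df0 I1 I2 I3 om x v := by
  refine fderiv_apply_of_hasDerivAt_line
    ((contDiffAt_f0 I1 I2 I3 om hx).differentiableAt (by simp)) ?_
  have H := hasDerivAt_coord_line x v
  have Q := hasDerivAt_q4_line hx v
  have P := ((H 3).mul Q).add ((H 4).mul (H 5))
  have R := ((((H 3).pow 2).const_mul 2).add (((H 4).pow 2).const_mul 2)).sub_const 1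
  rw [hasDerivAt_pi]
  intro i
  fin_cases i
  · refine ((((H 1).mul (H 2)).const_mul ((I2 - I3) / I1)).add
      ((P.mul R).const_mul (6 * om ^ 2 * (I2 - I3) / I1))).congr_deriv ?_
    simp [df0, -mul_eq_mul_left_iff]
    ring
  · refine ((((H 0).mul (H 2)).const_mul ((I3 - I1) / I2)).add
      (((((H 3).mul (H 5)).sub ((H 4).mul Q)).mul R).const_mul
        (6 * om ^ 2 * (I3 - I1) / I2))).congr_deriv ?_
    simp [df0, -mul_eq_mul_left_iff]
    ring
  · refine ((((H 0).mul (H 1)).const_mul ((I1 - I2) / I3)).add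
      ((P.mul (((H 4).mul Q).sub ((H 3).mul (H 5)))).const_mul
        (12 * om ^ 2 * (I1 - I2) / I3))).congr_deriv ?_
    simp [df0]
  · refine ((((((H 0).add_const om).mul Q).sub ((H 1).mul (H 5))).add
      ((H 2).mul (H 4))).const_mul (1 / 2)).congr_deriv ?_
    simp [df0]
  · refine ((((((H 0).sub_const om).mul (H 5)).add ((H 1).mul Q)).sub
      ((H 2).mul (H 3))).const_mul (1 / 2)).congr_deriv ?_
    simp [df0]
  · refine ((((((H 0).sub_const om).neg.mul (H 4)).add ((H 1).mul (H 3))).add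
      ((H 2).mul Q)).const_mul (1 / 2)).congr_deriv ?_
    simp [df0]

theorem fderiv_f2_apply (I1 I3 b : ℝ) {x : Fin 6 → ℝ}
    (hx : 0 < 1 - x 3 ^ 2 - x 4 ^ 2 - x 5 ^ 2) (v : Fin 6 → ℝ) :
    fderiv ℝ (f2 I1 I3 b) x v =
      ![2 * b * (v 3 * x 5 + x 3 * v 5 + (v 4 * q4 x + x 4 * dq4 x v)) / I1, 0,
        b * (4 * x 4 * v 4 + 4 * x 5 * v 5) / I3, 0, 0, 0] := by
  refine fderiv_apply_of_hasDerivAt_line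
    ((contDiffAt_f2 I1 I3 b hx).differentiableAt (by simp)) ?_
  have H := hasDerivAt_coord_line x v
  have Q := hasDerivAt_q4_line hx v
  rw [hasDerivAt_pi]
  intro i
  fin_cases i
  · refine (((((H 3).mul (H 5)).add ((H 4).mul Q)).const_mul (2 * b)).div_const I1).congr_deriv ?_
    simp
  · exact hasDerivAt_const _ _
  · refine (((((((H 4).pow 2).const_mul 2).add (((H 5).pow 2).const_mul 2)).sub_const 1).const_mul
      b).div_const I3).congr_deriv ?_
    simp
    ring
  all_goals exact hasDerivAt_const _ _

theorem fderiv_f3_apply (I1 I2 b : ℝ) {x : Fin 6 → ℝ}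
    (hx : 0 < 1 - x 3 ^ 2 - x 4 ^ 2 - x 5 ^ 2) (v : Fin 6 → ℝ) :
    fderiv ℝ (f3 I1 I2 b) x v =
      ![2 * b * (v 5 * q4 x + x 5 * dq4 x v - (v 3 * x 4 + x 3 * v 4)) / I1,
        b * (-(4 * x 4 * v 4) - 4 * x 5 * v 5) / I2, 0, 0, 0, 0] := by
  refine fderiv_apply_of_hasDerivAt_line
    ((contDiffAt_f3 I1 I2 b hx).differentiableAt (by simp)) ?_
  have H := hasDerivAt_coord_line x v
  have Q := hasDerivAt_q4_line hx v
  rw [hasDerivAt_pi]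
  intro i
  fin_cases i
  · refine (((((H 5).mul Q).sub ((H 3).mul (H 4))).const_mul (2 * b)).div_const I1).congr_deriv ?_
    simp
  · refine (((((((H 4).pow 2).const_mul 2).const_sub 1).sub (((H 5).pow 2).const_mul 2)).const_mul
      b).div_const I2).congr_deriv ?_
    simp
    ring
  all_goals exact hasDerivAt_const _ _

theorem lieB_f0_f3_apply (I1 I2 I3 om b a s c : ℝ) (hc : 0 < 1 - c ^ 2) :
    lieB (f0 I1 I2 I3 om) (f3 I1 I2 b) ![-om, a, s, 0, 0, c] =
      ![b / I1 * s * (1 - 2 * c ^ 2) - (I2 - I3) / I1 * s * (b * (1 - 2 * c ^ 2) / I2),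
        -2 * b / I2 * c * s * √(1 - c ^ 2)
          - (I3 - I1) / I2 * s * (2 * b * c * √(1 - c ^ 2) / I1),
        -((I1 - I2) / I3 * (a * (2 * b * c * √(1 - c ^ 2) / I1)
          - om * (b * (1 - 2 * c ^ 2) / I2))),
        -(1 / 2) * (2 * b * c * (1 - c ^ 2) / I1 - b * (1 - 2 * c ^ 2) / I2 * c),
        -(1 / 2) * (2 * b * c ^ 2 * √(1 - c ^ 2) / I1 + b * (1 - 2 * c ^ 2) / I2 * √(1 - c ^ 2)),
        0] := by
  have hx : 0 < 1 - (![-om, a, s, 0, 0, c] : Fin 6 → ℝ) 3 ^ 2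
      - (![-om, a, s, 0, 0, c] : Fin 6 → ℝ) 4 ^ 2
      - (![-om, a, s, 0, 0, c] : Fin 6 → ℝ) 5 ^ 2 := by simpa using hc
  have hq : √(1 - c ^ 2) ≠ 0 := (Real.sqrt_pos.2 hc).ne'
  have hsq : √(1 - c ^ 2) ^ 2 = 1 - c ^ 2 := Real.sq_sqrt hc.le
  unfold lieB
  rw [fderiv_f0_apply _ _ _ _ hx, fderiv_f3_apply _ _ _ hx]
  ext i
  fin_cases i <;> simp [f0, f3, df0, dq4, q4, -mul_eq_mul_left_iff] <;> generalize √(1 - c ^ 2) = q at *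
  · have h1 : 1 / 2 * (s * q) * q + c * (-(c * (1 / 2 * (s * q))) / q) = s * (1 - 2 * c ^ 2) / 2 := by
      field_simp
      linear_combination s * hsq
    linear_combination 2 * b / I1 * h1
  all_goals first | ring1 | linear_combination 2 * b * c / I1 * hsq

theorem lieB_f0_lieB_f0_f3_apply (I1 I2 I3 om b s : ℝ) :
    lieB (f0 I1 I2 I3 om) (lieB (f0 I1 I2 I3 om) (f3 I1 I2 b)) ![-om, 0, s, 0, 0, 0] =
      ![0,
        -(b / I2 * s ^ 2) - (I3 - I1) / I2 * (b / I1) * s ^ 2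
          - ((I3 - I1) / I2 * ((b / I1 * s - (I2 - I3) / I1 * s * (b / I2)) * s
              - om * ((I1 - I2) / I3 * (om * (b / I2))))
            + 6 * om ^ 2 * (I3 - I1) / I2 * (-(1 / 2) * (b / I2))),
        0,
        -(1 / 2) * (b / I1 * s - b / I2 * (s / 2))
          - (1 / 2) * (b / I1 * s - (I2 - I3) / I1 * s * (b / I2) - s * (1 / 2 * (b / I2))),
        0,
        -((1 / 2) * (-(om * (b / I2)) + (I1 - I2) / I3 * (om * (b / I2))))] := by
  have hx : 0 < 1 - (![-om, 0, s, 0, 0, 0] : Fin 6 → ℝ) 3 ^ 2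
      - (![-om, 0, s, 0, 0, 0] : Fin 6 → ℝ) 4 ^ 2
      - (![-om, 0, s, 0, 0, 0] : Fin 6 → ℝ) 5 ^ 2 := by simp
  have hh := contDiffAt_lieB (contDiffAt_f0 I1 I2 I3 om hx) (contDiffAt_f3 I1 I2 b hx)
  have hf : f0 I1 I2 I3 om ![-om, 0, s, 0, 0, 0] =
      ![0, -((I3 - I1) / I2 * (om * s)), 0, 0, 0, s / 2] := by
    ext i
    fin_cases i <;> simp [f0, q4]
    ring
  have key : fderiv ℝ (lieB (f0 I1 I2 I3 om) (f3 I1 I2 b)) ![-om, 0, s, 0, 0, 0]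
      ![0, -((I3 - I1) / I2 * (om * s)), 0, 0, 0, s / 2] =
      ![0, -(b / I2 * s ^ 2) - (I3 - I1) / I2 * (b / I1) * s ^ 2, 0,
        -(1 / 2) * (b / I1 * s - b / I2 * (s / 2)), 0, 0] := by
    refine fderiv_apply_of_hasDerivAt_line (hh.differentiableAt (by simp)) ?_
    have hpos : ∀ᶠ t : ℝ in nhds 0, 0 < 1 - (t * (s / 2)) ^ 2 := by
      have : ContinuousAt (fun t : ℝ => 1 - (t * (s / 2)) ^ 2) 0 := by fun_prop
      exact this.eventually (lt_mem_nhds (by simp))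
    have hC : HasDerivAt (fun t : ℝ => t * (s / 2)) (s / 2) 0 := by
      simpa using (hasDerivAt_id (0 : ℝ)).mul_const (s / 2)
    have hA : HasDerivAt (fun t : ℝ => t * -((I3 - I1) / I2 * (om * s)))
        (-((I3 - I1) / I2 * (om * s))) 0 := by
      simpa using (hasDerivAt_id (0 : ℝ)).mul_const (-((I3 - I1) / I2 * (om * s)))
    have hP := (hC.pow 2).const_sub 1
    have hQ := hP.sqrt (by simp)
    have hR := ((hC.pow 2).const_mul 2).const_sub 1
    have heq : (fun t : ℝ => lieB (f0 I1 I2 I3 om) (f3 I1 I2 b) (![-om, 0, s, 0, 0, 0] +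
        t • ![0, -((I3 - I1) / I2 * (om * s)), 0, 0, 0, s / 2])) =ᶠ[nhds 0] fun t =>
        lieB (f0 I1 I2 I3 om) (f3 I1 I2 b)
          ![-om, t * -((I3 - I1) / I2 * (om * s)), s, 0, 0, t * (s / 2)] := by
      refine Filter.Eventually.of_forall fun t => congrArg _ ?_
      ext i
      fin_cases i <;> simp
    refine HasDerivAt.congr_of_eventuallyEq ?_ (heq.trans
      (hpos.mono fun t ht => lieB_f0_f3_apply I1 I2 I3 om b _ s _ ht))
    rw [hasDerivAt_pi]
    intro i
    fin_cases i
    · refine ((hR.const_mul (b / I1 * s)).sub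
        (((hR.const_mul b).div_const I2).const_mul ((I2 - I3) / I1 * s))).congr_deriv ?_
      simp
    · refine ((((hC.const_mul (-2 * b / I2)).mul_const s).mul hQ).sub
        ((((hC.const_mul (2 * b)).mul hQ).div_const I1).const_mul
          ((I3 - I1) / I2 * s))).congr_deriv ?_
      simp
      ring
    · refine (((hA.mul (((hC.const_mul (2 * b)).mul hQ).div_const I1)).sub
        (((hR.const_mul b).div_const I2).const_mul om)).const_mul ((I1 - I2) / I3)).neg.congr_deriv ?_
      simp
    · refine (((((hC.const_mul (2 * b)).mul hP).div_const I1).sub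
        (((hR.const_mul b).div_const I2).mul hC)).const_mul (-(1 / 2))).congr_deriv ?_
      simp
      ring
    · refine ((((((hC.pow 2).const_mul (2 * b)).mul hQ).div_const I1).add
        (((hR.const_mul b).div_const I2).mul hQ)).const_mul (-(1 / 2))).congr_deriv ?_
      simp
    · exact hasDerivAt_const _ _
  have hval := lieB_f0_f3_apply I1 I2 I3 om b 0 s 0 (by simp)
  rw [lieB, hf, key, hval, fderiv_f0_apply _ _ _ _ hx]
  ext i
  fin_cases i <;> simp [df0, dq4, q4, -mul_eq_mul_left_iff]
  all_goals ring

/-- g4 = [f2, [f0, [f0, f3]]] evaluated at x_e. -/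
theorem bracket_g4_at_equilibrium (I1 I2 I3 om b : ℝ)
    (hI1 : 0 < I1) (hI2 : 0 < I2) (hI3 : 0 < I3) (hom : om ≠ 0) (hb : b ≠ 0) :
    lieB (f2 I1 I3 b) (lieB (f0 I1 I2 I3 om) (lieB (f0 I1 I2 I3 om) (f3 I1 I2 b))) (xe om)
      = ![0, 0, 0, b ^ 2 * (I2 + I3 - I1) / (2 * I1 * I2 * I3), 0, 0] := by
  have hx : ∀ s : ℝ, 0 < 1 - (![-om, 0, s, 0, 0, 0] : Fin 6 → ℝ) 3 ^ 2
      - (![-om, 0, s, 0, 0, 0] : Fin 6 → ℝ) 4 ^ 2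
      - (![-om, 0, s, 0, 0, 0] : Fin 6 → ℝ) 5 ^ 2 := by simp
  have hx0 := hx 0
  have hk := contDiffAt_lieB (contDiffAt_f0 I1 I2 I3 om hx0)
    (contDiffAt_lieB (contDiffAt_f0 I1 I2 I3 om hx0) (contDiffAt_f3 I1 I2 b hx0))
  have hf : f2 I1 I3 b ![-om, 0, 0, 0, 0, 0] = ![0, 0, -b / I3, 0, 0, 0] := by
    ext i
    fin_cases i <;> simp [f2]
  have key : fderiv ℝ (lieB (f0 I1 I2 I3 om) (lieB (f0 I1 I2 I3 om) (f3 I1 I2 b)))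
      ![-om, 0, 0, 0, 0, 0] ![0, 0, -b / I3, 0, 0, 0] =
      ![0, 0, 0, b ^ 2 * (I2 + I3 - I1) / (2 * I1 * I2 * I3), 0, 0] := by
    refine fderiv_apply_of_hasDerivAt_line (hk.differentiableAt (by simp)) ?_
    have heq : (fun t : ℝ => lieB (f0 I1 I2 I3 om) (lieB (f0 I1 I2 I3 om) (f3 I1 I2 b))
        (![-om, 0, 0, 0, 0, 0] + t • ![0, 0, -b / I3, 0, 0, 0])) = fun t =>
        lieB (f0 I1 I2 I3 om) (lieB (f0 I1 I2 I3 om) (f3 I1 I2 b))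
          ![-om, 0, t * (-b / I3), 0, 0, 0] := by
      refine funext fun t => congrArg _ ?_
      ext i
      fin_cases i <;> simp
    rw [heq]
    simp only [lieB_f0_lieB_f0_f3_apply]
    have hS : HasDerivAt (fun t : ℝ => t * (-b / I3)) (-b / I3) 0 := by
      simpa using (hasDerivAt_id (0 : ℝ)).mul_const (-b / I3)
    rw [hasDerivAt_pi]
    intro i
    fin_cases i
    · exact hasDerivAt_const _ _
    · refine ((((hS.pow 2).const_mul (b / I2)).neg.sub
        ((hS.pow 2).const_mul ((I3 - I1) / I2 * (b / I1)))).sub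
        ((((((hS.const_mul (b / I1)).sub ((hS.const_mul ((I2 - I3) / I1)).mul_const (b / I2))).mul
          hS).sub_const (om * ((I1 - I2) / I3 * (om * (b / I2))))).const_mul
            ((I3 - I1) / I2)).add_const _)).congr_deriv ?_
      simp
    · exact hasDerivAt_const _ _
    · refine ((((hS.const_mul (b / I1)).sub ((hS.div_const 2).const_mul (b / I2))).const_mul
        (-(1 / 2))).sub ((((hS.const_mul (b / I1)).sub
          ((hS.const_mul ((I2 - I3) / I1)).mul_const (b / I2))).sub
            (hS.mul_const (1 / 2 * (b / I2)))).const_mul (1 / 2))).congr_deriv ?_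
      simp
      field_simp
      ring
    · exact hasDerivAt_const _ _
    · exact hasDerivAt_const _ _
  rw [xe, lieB, hf, key, lieB_f0_lieB_f0_f3_apply, fderiv_f2_apply _ _ _ hx0]
  ext i
  fin_cases i <;> simp [dq4]
end

section
/- (Lie algebra rank condition) Assume I1 ≠ I2 + I3 and I2 ≠ I3. Then the six vectors v1 = ( 3ω0²β²(I1−I2−I3)(I2−I3)/(I1²I2I3), 0, 0, 0, 0, 0 ), v2 = (0, β/I2, 0, 0, 0, 0), v3 = (0, 0, −β/I3, 0, 0, 0), v4 = (0, 0, 0, β²(I2+I3−I1)/(2I1I2I3), 0, 0), v5 = (0, 0, ω0β(I1−I2)/(I2I3), 0, −β/(2I2), 0), v6 = (0, ω0β(I1−I3)/(I2I3), 0, 0, 0, β/(2I3)) span all of ℝ^6. (These are the values at the equilibrium x_e of the iterated Lie brackets g1 = [f0,[f3,[f0,[f0,f2]]]], g2 = f3, g3 = f2, g4 = [f2,[f0,[f0,f3]]], g5 = [f0,f3], g6 = [f0,f2] of the satellite system; hence the Lie algebra rank condition holds at x_e.) -/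
/-- Six vectors of `ℝ⁶` in triangular position with nonzero pivots span the whole space. -/
theorem span_six_triangular_eq_top {a b c d e f p q : ℝ} (ha : a ≠ 0) (hb : b ≠ 0) (hc : c ≠ 0)
    (hd : d ≠ 0) (he : e ≠ 0) (hf : f ≠ 0) :
    Submodule.span ℝ
      ({![a, 0, 0, 0, 0, 0], ![0, b, 0, 0, 0, 0], ![0, 0, c, 0, 0, 0], ![0, 0, 0, d, 0, 0],
        ![0, 0, p, 0, e, 0], ![0, q, 0, 0, 0, f]} : Set (Fin 6 → ℝ)) = ⊤ := by
  refine eq_top_iff.mpr fun x _ => ?_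
  simp only [Submodule.mem_span_insert, Submodule.mem_span_singleton]
  refine ⟨x 0 / a, _, ⟨(x 1 - x 5 / f * q) / b, _, ⟨(x 2 - x 4 / e * p) / c, _, ⟨x 3 / d, _,
    ⟨x 4 / e, _, ⟨x 5 / f, rfl⟩, rfl⟩, rfl⟩, rfl⟩, rfl⟩, ?_⟩
  ext i
  fin_cases i <;> simp [ha, hb, hc, hd, he, hf]

/-- Lie algebra rank condition: if I1 ≠ I2 + I3 and I2 ≠ I3, then the values
at the equilibrium of the six "good" brackets g1, …, g6 span all of ℝ⁶. -/
theorem good_brackets_span (I1 I2 I3 om b : ℝ)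
    (hI1 : 0 < I1) (hI2 : 0 < I2) (hI3 : 0 < I3) (hom : om ≠ 0) (hb : b ≠ 0)
    (h1 : I1 ≠ I2 + I3) (h2 : I2 ≠ I3) :
    Submodule.span ℝ
      ({![3 * om ^ 2 * b ^ 2 * (I1 - I2 - I3) * (I2 - I3) / (I1 ^ 2 * I2 * I3), 0, 0, 0, 0, 0],
        ![0, b / I2, 0, 0, 0, 0],
        ![0, 0, -(b / I3), 0, 0, 0],
        ![0, 0, 0, b ^ 2 * (I2 + I3 - I1) / (2 * I1 * I2 * I3), 0, 0],
        ![0, 0, om * b * (I1 - I2) / (I2 * I3), 0, -(b / (2 * I2)), 0],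
        ![0, om * b * (I1 - I3) / (I2 * I3), 0, 0, 0, b / (2 * I3)]} : Set (Fin 6 → ℝ)) = ⊤ := by
  have h1' : I1 - I2 - I3 ≠ 0 := fun h => h1 (by linarith)
  have h1'' : I2 + I3 - I1 ≠ 0 := fun h => h1 (by linarith)
  have h2' : I2 - I3 ≠ 0 := sub_ne_zero.mpr h2
  have hI1' := hI1.ne'
  have hI2' := hI2.ne'
  have hI3' := hI3.ne'
  apply span_six_triangular_eq_top <;> simp [*]
end

section
/- The iterated Lie bracket h1 := [f2, [f0, [f0, [f0, f2]]]], evaluated at the equilibrium x_e = (−ω0, 0, 0, 0, 0, 0), equals ( 0, 0, 0, −ω0·β²·(I1² − (I2 + 2I3)·I1 + 2·I2·I3 + I3²)/(I1·I2·I3²), 0, 0 ), i.e. a scalar multiple of the fourth standard basis vector of ℝ^6. -/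
open scoped ContDiff Topology

section TwoJet

variable {E F : Type*} [NormedAddCommGroup E] [NormedSpace ℝ E]
  [NormedAddCommGroup F] [NormedSpace ℝ F]

/-- `f` is smooth at `a`, with value `c`, first derivative `L` and second derivative `B` there. -/
structure HasTwoJetAt (f : E → F) (a : E) (c : F) (L : E → F) (B : E → E → F) : Prop where
  contDiffAt : ContDiffAt ℝ ∞ f a
  value : f a = c
  fst : ∀ v, fderiv ℝ f a v = L v
  snd : ∀ v w, fderiv ℝ (fderiv ℝ f) a v w = B v w

lemma ContDiffAt.fderiv_smooth {f : E → F} {a : E} (hf : ContDiffAt ℝ ∞ f a) :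
    ContDiffAt ℝ ∞ (fderiv ℝ f) a :=
  hf.fderiv_right (by norm_num)

lemma ContDiffAt.eventually_differentiableAt {f : E → F} {a : E} (hf : ContDiffAt ℝ ∞ f a) :
    ∀ᶠ x in 𝓝 a, DifferentiableAt ℝ f x := by
  have h1 : ContDiffAt ℝ 1 f a := hf.of_le (by norm_cast)
  filter_upwards [h1.eventually (by simp)] with x hx
  exact hx.differentiableAt (by simp)

lemma ContDiffAt.differentiableAt_of_smooth {f : E → F} {a : E} (hf : ContDiffAt ℝ ∞ f a) :
    DifferentiableAt ℝ f a :=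
  hf.differentiableAt (by simp)

namespace HasTwoJetAt

lemma const (a : E) (c : F) : HasTwoJetAt (fun _ => c) a c (fun _ => 0) (fun _ _ => 0) where
  contDiffAt := contDiffAt_const
  value := rfl
  fst v := by simp
  snd v w := by
    have h : fderiv ℝ (fun _ : E => c) = fun _ => 0 := by ext; simp
    simp [h]

lemma clm (T : E →L[ℝ] F) (a : E) : HasTwoJetAt (fun x => T x) a (T a) T (fun _ _ => 0) where
  contDiffAt := T.contDiff.contDiffAt
  value := rfl
  fst v := by simp
  snd v w := by
    have h : fderiv ℝ (fun x => T x) = fun _ => T := by ext; simp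
    simp [h]

variable {f g : E → ℝ} {a : E} {c d : ℝ} {L M : E → ℝ} {B C : E → E → ℝ}

lemma add (hf : HasTwoJetAt f a c L B) (hg : HasTwoJetAt g a d M C) :
    HasTwoJetAt (fun x => f x + g x) a (c + d) (fun v => L v + M v)
      (fun v w => B v w + C v w) where
  contDiffAt := hf.contDiffAt.add hg.contDiffAt
  value := by rw [hf.value, hg.value]
  fst v := by
    rw [fderiv_fun_add hf.contDiffAt.differentiableAt_of_smooth
      hg.contDiffAt.differentiableAt_of_smooth]
    simp [hf.fst, hg.fst]
  snd v w := by
    have h : fderiv ℝ (fun x => f x + g x) =ᶠ[𝓝 a] fun x => fderiv ℝ f x + fderiv ℝ g x := by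
      filter_upwards [hf.contDiffAt.eventually_differentiableAt,
        hg.contDiffAt.eventually_differentiableAt] with x hx hy
      exact fderiv_fun_add hx hy
    rw [h.fderiv_eq, fderiv_fun_add hf.contDiffAt.fderiv_smooth.differentiableAt_of_smooth
      hg.contDiffAt.fderiv_smooth.differentiableAt_of_smooth]
    simp [hf.snd, hg.snd]

lemma mul (hf : HasTwoJetAt f a c L B) (hg : HasTwoJetAt g a d M C) :
    HasTwoJetAt (fun x => f x * g x) a (c * d) (fun v => c * M v + d * L v)
      (fun v w => c * C v w + L v * M w + (d * B v w + M v * L w)) where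
  contDiffAt := hf.contDiffAt.mul hg.contDiffAt
  value := by rw [hf.value, hg.value]
  fst v := by
    rw [fderiv_fun_mul hf.contDiffAt.differentiableAt_of_smooth
      hg.contDiffAt.differentiableAt_of_smooth]
    simp [hf.fst, hg.fst, hf.value, hg.value]
  snd v w := by
    have hf0 := hf.contDiffAt.differentiableAt_of_smooth
    have hg0 := hg.contDiffAt.differentiableAt_of_smooth
    have hf1 := hf.contDiffAt.fderiv_smooth.differentiableAt_of_smooth
    have hg1 := hg.contDiffAt.fderiv_smooth.differentiableAt_of_smooth
    have h : fderiv ℝ (fun x => f x * g x) =ᶠ[𝓝 a]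
        fun x => f x • fderiv ℝ g x + g x • fderiv ℝ f x := by
      filter_upwards [hf.contDiffAt.eventually_differentiableAt,
        hg.contDiffAt.eventually_differentiableAt] with x hx hy
      exact fderiv_fun_mul hx hy
    rw [h.fderiv_eq, fderiv_fun_add (hf0.fun_smul hg1) (hg0.fun_smul hf1),
      fderiv_fun_smul hf0 hg1, fderiv_fun_smul hg0 hf1]
    simp [hf.fst, hg.fst, hf.value, hg.value, hf.snd, hg.snd]

lemma const_mul (k : ℝ) (hf : HasTwoJetAt f a c L B) :
    HasTwoJetAt (fun x => k * f x) a (k * c) (fun v => k * L v) (fun v w => k * B v w) := by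
  simpa using (HasTwoJetAt.const a k).mul hf

lemma sub (hf : HasTwoJetAt f a c L B) (hg : HasTwoJetAt g a d M C) :
    HasTwoJetAt (fun x => f x - g x) a (c - d) (fun v => L v - M v)
      (fun v w => B v w - C v w) := by
  simpa [sub_eq_add_neg] using hf.add (hg.const_mul (-1))

lemma congr_jet (hf : HasTwoJetAt f a c L B) (hc : c = d) (hL : ∀ v, L v = M v)
    (hB : ∀ v w, B v w = C v w) : HasTwoJetAt f a d M C := by
  obtain rfl : L = M := funext hL
  obtain rfl : B = C := funext fun v => funext (hB v)
  exact hc ▸ hf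

lemma pi {ι : Type*} [Fintype ι] {f : E → ι → ℝ} {c : ι → ℝ} {L : E → ι → ℝ}
    {B : E → E → ι → ℝ}
    (h : ∀ i, HasTwoJetAt (fun x => f x i) a (c i) (fun v => L v i) (fun v w => B v w i)) :
    HasTwoJetAt f a c L B := by
  have hs : ContDiffAt ℝ ∞ f a := contDiffAt_pi.2 fun i => (h i).contDiffAt
  have key : ∀ x, DifferentiableAt ℝ f x → ∀ i,
      fderiv ℝ (fun y => f y i) x = (ContinuousLinearMap.proj i).comp (fderiv ℝ f x) :=
    fun x hx i => (hasFDerivAt_pi'.1 hx.hasFDerivAt i).fderiv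
  refine ⟨hs, funext fun i => (h i).value, fun v => funext fun i => ?_,
    fun v w => funext fun i => ?_⟩
  · rw [← (h i).fst v, key a hs.differentiableAt_of_smooth i]
    rfl
  · have he : fderiv ℝ (fun y => f y i) =ᶠ[𝓝 a]
        fun x => (ContinuousLinearMap.compL ℝ E (ι → ℝ) ℝ (ContinuousLinearMap.proj i))
          (fderiv ℝ f x) := by
      filter_upwards [hs.eventually_differentiableAt] with x hx
      exact key x hx i
    rw [← (h i).snd v w, (((ContinuousLinearMap.hasFDerivAt _).comp a
      hs.fderiv_smooth.differentiableAt_of_smooth.hasFDerivAt).congr_of_eventuallyEq he).fderiv]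
    rfl

end HasTwoJetAt

end TwoJet

lemma ContDiffAt.lieB {f g : (Fin 6 → ℝ) → (Fin 6 → ℝ)} {a : Fin 6 → ℝ}
    (hf : ContDiffAt ℝ ∞ f a) (hg : ContDiffAt ℝ ∞ g a) : ContDiffAt ℝ ∞ (lieB f g) a :=
  (hg.fderiv_smooth.clm_apply hf).sub (hf.fderiv_smooth.clm_apply hg)

/-- The value of a bracket with a field vanishing at `a`. -/
lemma lieB_apply_of_eq_zero {f g : (Fin 6 → ℝ) → (Fin 6 → ℝ)} {a : Fin 6 → ℝ} (hfa : f a = 0) :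
    lieB f g a = -fderiv ℝ f a (g a) := by
  simp [lieB, hfa]

/-- The derivative of a bracket with a field vanishing at `a`. -/
lemma fderiv_lieB_of_eq_zero {f g : (Fin 6 → ℝ) → (Fin 6 → ℝ)} {a : Fin 6 → ℝ}
    (hf : ContDiffAt ℝ ∞ f a) (hg : ContDiffAt ℝ ∞ g a) (hfa : f a = 0) (v : Fin 6 → ℝ) :
    fderiv ℝ (lieB f g) a v = fderiv ℝ g a (fderiv ℝ f a v) - fderiv ℝ f a (fderiv ℝ g a v)
      - fderiv ℝ (fderiv ℝ f) a v (g a) := by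
  have h := (hg.fderiv_smooth.differentiableAt_of_smooth.hasFDerivAt.clm_apply
    hf.differentiableAt_of_smooth.hasFDerivAt).sub
      (hf.fderiv_smooth.differentiableAt_of_smooth.hasFDerivAt.clm_apply
        hg.differentiableAt_of_smooth.hasFDerivAt)
  have h' : HasFDerivAt (lieB f g) _ a := h
  rw [h'.fderiv]
  simp [hfa]
  abel

lemma hasTwoJetAt_coord (i : Fin 6) (a : Fin 6 → ℝ) :
    HasTwoJetAt (fun x => x i) a (a i) (fun v => v i) (fun _ _ => 0) :=
  HasTwoJetAt.clm (ContinuousLinearMap.proj (R := ℝ) (φ := fun _ : Fin 6 => ℝ) i) a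

lemma hasTwoJetAt_q4 (om : ℝ) : ∃ B, HasTwoJetAt q4 (xe om) 1 (fun _ => 0) B := by
  have hr : HasTwoJetAt (fun x : Fin 6 → ℝ => 1 - x 3 ^ 2 - x 4 ^ 2 - x 5 ^ 2) (xe om) 1
      (fun _ => 0) (fun v w => -2 * (v 3 * w 3 + v 4 * w 4 + v 5 * w 5)) := by
    have X := fun i => hasTwoJetAt_coord i (xe om)
    simp only [pow_two]
    refine ((((HasTwoJetAt.const (xe om) (1 : ℝ)).sub ((X 3).mul (X 3))).sub
      ((X 4).mul (X 4))).sub ((X 5).mul (X 5))).congr_jet ?_ ?_ ?_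
    · simp [xe]
    · simp [xe]
    · intro v w
      simp [xe]
      ring
  have hd : HasFDerivAt q4 _ (xe om) :=
    hr.contDiffAt.differentiableAt_of_smooth.hasFDerivAt.sqrt (by rw [hr.value]; exact one_ne_zero)
  refine ⟨fun v w => fderiv ℝ (fderiv ℝ q4) (xe om) v w, ?_, ?_, fun v => ?_, fun _ _ => rfl⟩
  · exact hr.contDiffAt.sqrt (by rw [hr.value]; exact one_ne_zero)
  · simp [q4, hr.value]
  · rw [hd.fderiv]
    simp [hr.fst]

/-- The two-jet of the drift at the equilibrium. -/
lemma hasTwoJetAt_f0 (I1 I2 I3 om : ℝ) :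
    HasTwoJetAt (f0 I1 I2 I3 om) (xe om) 0
      (fun v => ![-(6 * om ^ 2 * ((I2 - I3) / I1) * v 3),
        (I3 - I1) / I2 * (6 * om ^ 2 * v 4 - om * v 2),
        -((I1 - I2) / I3 * (om * v 1)),
        1 / 2 * v 0,
        1 / 2 * (v 1 - 2 * om * v 5),
        1 / 2 * (2 * om * v 4 + v 2)])
      (fun v w => ![(I2 - I3) / I1 * (v 1 * w 2 + v 2 * w 1 - 6 * om ^ 2 * (v 4 * w 5 + v 5 * w 4)),
        (I3 - I1) / I2 * (v 0 * w 2 + v 2 * w 0 - 6 * om ^ 2 * (v 3 * w 5 + v 5 * w 3)),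
        (I1 - I2) / I3 * (v 0 * w 1 + v 1 * w 0 + 12 * om ^ 2 * (v 3 * w 4 + v 4 * w 3)),
        1 / 2 * (v 2 * w 4 + v 4 * w 2 - (v 1 * w 5 + v 5 * w 1)),
        1 / 2 * (v 0 * w 5 + v 5 * w 0 - (v 2 * w 3 + v 3 * w 2)),
        1 / 2 * (v 1 * w 3 + v 3 * w 1 - (v 0 * w 4 + v 4 * w 0))]) := by
  obtain ⟨Q, hQ⟩ := hasTwoJetAt_q4 om
  have X := fun i => hasTwoJetAt_coord i (xe om)
  have K := fun k : ℝ => HasTwoJetAt.const (xe om) k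
  have hP := ((((X 3).mul (X 3)).const_mul 2).add (((X 4).mul (X 4)).const_mul 2)).sub (K 1)
  have hR := ((X 3).mul hQ).add ((X 4).mul (X 5))
  refine HasTwoJetAt.pi fun i => ?_
  fin_cases i <;> simp only [f0, pow_two (_ : ℝ)]
  · refine ((((X 1).mul (X 2)).const_mul _).add ((hR.mul hP).const_mul _)).congr_jet ?_ ?_ ?_ <;>
      intros <;> simp [xe, -mul_eq_mul_right_iff] <;> ring
  · refine ((((X 0).mul (X 2)).const_mul _).add (((((X 3).mul (X 5)).sub ((X 4).mul hQ)).mul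
      hP).const_mul _)).congr_jet ?_ ?_ ?_ <;>
      intros <;> simp [xe, -mul_eq_mul_right_iff] <;> ring
  · refine ((((X 0).mul (X 1)).const_mul _).add ((hR.mul
      (((X 4).mul hQ).sub ((X 3).mul (X 5)))).const_mul _)).congr_jet ?_ ?_ ?_ <;>
      intros <;> simp [xe, -mul_eq_mul_right_iff] <;> ring
  · refine ((((((X 0).add (K om)).mul hQ).sub ((X 1).mul (X 5))).add
      ((X 2).mul (X 4))).const_mul _).congr_jet ?_ ?_ ?_ <;>
      intros <;> simp [xe, -mul_eq_mul_right_iff] <;> ring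
  · refine ((((((X 0).sub (K om)).mul (X 5)).add ((X 1).mul hQ)).sub
      ((X 2).mul (X 3))).const_mul _).congr_jet ?_ ?_ ?_ <;>
      intros <;> simp [xe, -mul_eq_mul_right_iff] <;> ring
  · simp only [← neg_one_mul (_ - om : ℝ)]
    refine (((((((X 0).sub (K om)).const_mul _).mul (X 4)).add ((X 1).mul (X 3))).add
      ((X 2).mul hQ)).const_mul _).congr_jet ?_ ?_ ?_ <;>
      intros <;> simp [xe, -mul_eq_mul_right_iff] <;> ring

/-- The one-jet of the control field `f2` at the equilibrium. -/
lemma hasTwoJetAt_f2 (I1 I3 b om : ℝ) :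
    ∃ B, HasTwoJetAt (f2 I1 I3 b) (xe om) ![0, 0, -(b / I3), 0, 0, 0]
      (fun v => ![2 * b * v 4 / I1, 0, 0, 0, 0, 0]) B := by
  obtain ⟨Q, hQ⟩ := hasTwoJetAt_q4 om
  have X := fun i => hasTwoJetAt_coord i (xe om)
  have K := fun k : ℝ => HasTwoJetAt.const (xe om) k
  obtain ⟨B₁, h₁⟩ : ∃ B, HasTwoJetAt (fun x => f2 I1 I3 b x 0) (xe om) 0
      (fun v => 2 * b * v 4 / I1) B := by
    simp only [f2, div_eq_mul_inv]
    exact ⟨_, (((((X 3).mul (X 5)).add ((X 4).mul hQ)).const_mul (2 * b)).mul (K I1⁻¹)).congr_jet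
      (by simp [xe]) (fun v => by simp [xe]; ring) (fun v w => rfl)⟩
  obtain ⟨B₃, h₃⟩ : ∃ B, HasTwoJetAt (fun x => f2 I1 I3 b x 2) (xe om) (-(b / I3))
      (fun _ => 0) B := by
    simp only [f2, pow_two, div_eq_mul_inv]
    exact ⟨_, (((((((X 4).mul (X 4)).const_mul 2).add (((X 5).mul (X 5)).const_mul 2)).sub
      (K 1)).const_mul b).mul (K I3⁻¹)).congr_jet
      (by simp [xe]) (fun v => by simp [xe]) (fun v w => rfl)⟩
  refine ⟨fun v w => ![B₁ v w, 0, B₃ v w, 0, 0, 0], HasTwoJetAt.pi fun i => ?_⟩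
  fin_cases i
  · exact h₁
  · exact K 0
  · exact h₃
  all_goals exact K 0

/-- h1 = [f2, [f0, [f0, [f0, f2]]]] evaluated at x_e. -/
theorem bracket_h1_at_equilibrium (I1 I2 I3 om b : ℝ)
    (hI1 : 0 < I1) (hI2 : 0 < I2) (hI3 : 0 < I3) (hom : om ≠ 0) (hb : b ≠ 0) :
    lieB (f2 I1 I3 b)
        (lieB (f0 I1 I2 I3 om) (lieB (f0 I1 I2 I3 om) (lieB (f0 I1 I2 I3 om) (f2 I1 I3 b)))) (xe om)
      = ![0, 0, 0,
          -(om * b ^ 2 * (I1 ^ 2 - (I2 + 2 * I3) * I1 + 2 * I2 * I3 + I3 ^ 2) / (I1 * I2 * I3 ^ 2)),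
          0, 0] := by
  have hf := hasTwoJetAt_f0 I1 I2 I3 om
  obtain ⟨C, hg⟩ := hasTwoJetAt_f2 I1 I3 b om
  have s0 := hg.contDiffAt
  have s1 := hf.contDiffAt.lieB s0
  have s2 := hf.contDiffAt.lieB s1
  rw [lieB, lieB_apply_of_eq_zero hf.value, lieB_apply_of_eq_zero hf.value,
    lieB_apply_of_eq_zero hf.value]
  simp only [fderiv_lieB_of_eq_zero hf.contDiffAt s2 hf.value,
    fderiv_lieB_of_eq_zero hf.contDiffAt s1 hf.value,
    fderiv_lieB_of_eq_zero hf.contDiffAt s0 hf.value,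
    lieB_apply_of_eq_zero hf.value, hf.fst, hf.snd, hg.fst, hg.value]
  ext i
  fin_cases i <;> simp
  field_simp
  ring
end

section
/- The iterated Lie bracket [f1, [f0, [f0, [f0, f1]]]] vanishes at the equilibrium: [f1, [f0, [f0, [f0, f1]]]](x_e) = 0, where x_e = (−ω0, 0, 0, 0, 0, 0). (Together with the values of h1 and h2, this shows that among the 'bad' brackets with three occurrences of f0 and two occurrences of a single controlled field f_i, the only brackets that are nonzero at x_e are h1 = [f2,[f0,[f0,[f0,f2]]]] and h2 = [f3,[f0,[f0,[f0,f3]]]].) -/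
/-- The bracket of two vector fields vanishing at a point vanishes at that point. -/
theorem lieB_eq_zero_of_eq_zero {f g : (Fin 6 → ℝ) → (Fin 6 → ℝ)} {x : Fin 6 → ℝ}
    (hf : f x = 0) (hg : g x = 0) : lieB f g x = 0 := by
  simp [lieB, hf, hg]

theorem f1_xe (I2 I3 b om : ℝ) : f1 I2 I3 b (xe om) = 0 := by
  ext i
  fin_cases i <;> simp [f1, xe]

/-- [f1, [f0, [f0, [f0, f1]]]] vanishes at the equilibrium x_e. -/
theorem bracket_h_f1_vanishes_at_equilibrium (I1 I2 I3 om b : ℝ)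
    (hI1 : 0 < I1) (hI2 : 0 < I2) (hI3 : 0 < I3) (hom : om ≠ 0) (hb : b ≠ 0) :
    lieB (f1 I2 I3 b)
        (lieB (f0 I1 I2 I3 om) (lieB (f0 I1 I2 I3 om) (lieB (f0 I1 I2 I3 om) (f1 I2 I3 b)))) (xe om)
      = 0 := by
  have h0 := f0_xe I1 I2 I3 om
  have h1 := f1_xe I2 I3 b om
  exact lieB_eq_zero_of_eq_zero h1 (lieB_eq_zero_of_eq_zero h0
    (lieB_eq_zero_of_eq_zero h0 (lieB_eq_zero_of_eq_zero h0 h1)))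
end
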